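/- For each λ > 0, the operator I - B_λ is invertible with ‖(I - B_λ)⁻¹‖ ≤ 1; write K_λ := (I - B_λ)⁻¹. Suppose there is a bounded operator K : H → H such that K_λ → K in the strong operator topology as λ → 0⁺ (i.e., K_λ x → K x for every x ∈ H along any sequence λ_n → 0⁺). Then for every g ∈ H and f := S^{1/2} g: λ^{1/2}u_λ → 0 in H as λ → 0⁺, and S^{1/2}u_λ → K g in H as λ → 0⁺. -/

import Mathlib

open ContinuousLinearMap Filter Topology

section KVHelpers

variable {H : Type*} [NormedAddCommGroup H] [InnerProductSpace ℂ H] [CompleteSpace H]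

lemma kv_commute (S T Q : H →L[ℂ] H) (l : ℝ) (hTT : T * T = S)
    (hQ : Q.IsPositive) (hQQ : Q * Q = (l : ℂ) • (1 : H →L[ℂ] H) + S) : Commute Q T := by
  have hQ0 : 0 ≤ Q := (ContinuousLinearMap.nonneg_iff_isPositive Q).2 hQ
  have h1 : Commute (Q * Q) T := by
    rw [hQQ, ← hTT]
    exact ((Commute.one_left T).smul_left _).add_left ((Commute.refl T).mul_left (Commute.refl T))
  have h2 : CFC.sqrt (Q * Q) = Q := CFC.sqrt_mul_self Q hQ0
  rw [← h2]
  exact h1.cfcₙ_nnreal _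

lemma kv_core (S T Q R : H →L[ℂ] H) (l : ℝ) (hl : 0 < l) (hT : T.IsPositive) (hTT : T * T = S)
    (hQ : Q.IsPositive) (hQQ : Q * Q = (l : ℂ) • (1 : H →L[ℂ] H) + S)
    (hQR : Q * R = 1) (hRQ : R * Q = 1) :
    (∀ x, T (R x) = R (T x)) ∧ (∀ x, l * ‖R x‖ ^ 2 + ‖R (T x)‖ ^ 2 = ‖x‖ ^ 2) ∧
    (∀ h, ‖R (T (S h)) - S h‖ ≤ l * ‖h‖) := by
  have hc := kv_commute S T Q l hTT hQ hQQ
  have qr : ∀ x, Q (R x) = x := fun x => congrArg (fun f : H →L[ℂ] H => f x) hQR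
  have rq : ∀ x, R (Q x) = x := fun x => congrArg (fun f : H →L[ℂ] H => f x) hRQ
  have qt : ∀ x, Q (T x) = T (Q x) := fun x => congrArg (fun f : H →L[ℂ] H => f x) hc.eq
  have tt : ∀ x, T (T x) = S x := fun x => congrArg (fun f : H →L[ℂ] H => f x) hTT
  have qq : ∀ x, Q (Q x) = (l : ℂ) • x + S x :=
    fun x => congrArg (fun f : H →L[ℂ] H => f x) hQQ
  have tr : ∀ x, T (R x) = R (T x) := by
    intro x
    rw [← rq (T (R x)), qt, qr]
  have key : ∀ x, l * ‖R x‖ ^ 2 + ‖R (T x)‖ ^ 2 = ‖x‖ ^ 2 := by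
    intro x
    set y := R x with hy
    have hx : x = Q y := (qr x).symm
    rw [← tr, ← hy, hx]
    have e1 : (inner ℂ (Q y) (Q y) : ℂ) = (l : ℂ) * inner ℂ y y + inner ℂ (T y) (T y) := by
      rw [← hQ.inner_left_eq_inner_right, qq, inner_add_left, inner_smul_left, ← tt,
        hT.inner_left_eq_inner_right]
      simp
    have e2 := congrArg Complex.re e1
    have n : ∀ z : H, (inner ℂ z z : ℂ).re = ‖z‖ ^ 2 := fun z => inner_self_eq_norm_sq (𝕜 := ℂ) z
    rw [Complex.add_re, Complex.re_ofReal_mul, n, n, n] at e2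
    exact e2.symm
  have vle : ∀ x, ‖R (T x)‖ ≤ ‖x‖ := by
    intro x
    have := key x
    have h2 : 0 ≤ l * ‖R x‖ ^ 2 := by positivity
    exact le_of_sq_le_sq (by linarith) (norm_nonneg _)
  have vpos : ∀ x, 0 ≤ (inner ℂ (R (T x)) x : ℂ).re := by
    intro x
    have hp : (T * Q).IsPositive := by
      rw [← ContinuousLinearMap.nonneg_iff_isPositive] at hT hQ ⊢
      exact Commute.mul_nonneg hT hQ hc.symm
    have := hp.re_inner_nonneg_left (R x)
    have e : (T * Q) (R x) = T x := congrArg T (qr x)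
    rw [e] at this
    have e2 : (inner ℂ (R (T x)) x : ℂ) = inner ℂ (T x) (R x) := by
      conv_lhs => rw [← qr x]
      rw [← hQ.inner_left_eq_inner_right, qr, qr]
    rw [e2]
    exact this
  refine ⟨tr, key, fun h => ?_⟩
  -- V = R T, (1 + V)(1 - V) S h = l V V h
  set d := R (T (S h)) - S h with hd
  have vv : ∀ x, R (T (R (T x))) = x - (l : ℂ) • R (R x) := by
    intro x
    rw [tr, tt]
    have h1 := qq (R (R x))
    rw [qr, qr] at h1
    have sr : S (R (R x)) = R (R (S x)) := by simp only [← tt, tr]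
    rw [← sr]; exact eq_sub_of_add_eq' h1.symm
  have e1 : d + R (T d) = -((l : ℂ) • R (T (R (T h)))) := by
    rw [hd, map_sub, map_sub, vv (S h), tr, tt]
    abel
  have e2 : ‖d + R (T d)‖ ≤ l * ‖h‖ := by
    rw [e1, norm_neg, norm_smul]
    simp only [Complex.norm_real, Real.norm_eq_abs, abs_of_pos hl]
    exact mul_le_mul_of_nonneg_left ((vle _).trans (vle _)) hl.le
  have e3 : ‖d‖ ≤ ‖d + R (T d)‖ := by
    apply le_of_sq_le_sq _ (norm_nonneg _)
    have := norm_add_sq (𝕜 := ℂ) (R (T d)) d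
    have h0 := vpos d
    rw [add_comm d]
    simp only [RCLike.re_to_complex] at this
    nlinarith [sq_nonneg ‖R (T d)‖]
  exact e3.trans e2

lemma kv_K (A Q R : H →L[ℂ] H) (hA : ContinuousLinearMap.adjoint A = -A) (hQ : Q.IsPositive)
    (hQR : Q * R = 1) (x : H) : ‖x‖ ≤ ‖(1 - R * A * R) x‖ := by
  have qr : ∀ x, Q (R x) = x := fun x => congrArg (fun f : H →L[ℂ] H => f x) hQR
  have e2 : (inner ℂ (R (A (R x))) x : ℂ) = inner ℂ (A (R x)) (R x) := by
    conv_lhs => rw [← qr x]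
    rw [← hQ.inner_left_eq_inner_right, qr, qr]
  have e3 : (inner ℂ (A (R x)) (R x) : ℂ).re = 0 := by
    have h1 := ContinuousLinearMap.adjoint_inner_left A (R x) (R x)
    rw [hA] at h1
    have h2 : (inner ℂ (R x) (A (R x)) : ℂ).re = (inner ℂ (A (R x)) (R x) : ℂ).re :=
      inner_re_symm (𝕜 := ℂ) _ _
    have h3 := congrArg Complex.re h1
    simp only [neg_apply, inner_neg_left, Complex.neg_re] at h3
    linarith
  have e4 : (1 - R * A * R) x = x - R (A (R x)) := rfl
  rw [e4]
  apply le_of_sq_le_sq _ (norm_nonneg _)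
  have := norm_sub_sq (𝕜 := ℂ) (R (A (R x))) x
  rw [e2] at this
  simp only [RCLike.re_to_complex, e3] at this
  rw [norm_sub_rev x]
  nlinarith [sq_nonneg ‖R (A (R x))‖]

end KVHelpers

/-- Lemma 1 of the paper.  With `B_λ = (λI+S)^{-1/2} A (λI+S)^{-1/2}`, the operator
`I - B_λ` is invertible with `‖K_λ‖ ≤ 1` where `K_λ := (I - B_λ)⁻¹`; and if
`K_λ → K` in the strong operator topology as `λ → 0⁺` for some bounded `K`, then for
every `g ∈ H` and `f := S^{1/2} g` we have `λ^{1/2} u_λ → 0` and `S^{1/2} u_λ → K g`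
as `λ → 0⁺`, where `u_λ = (λI - G)⁻¹ f` and `G = -S + A`. -/
theorem Klambda_strong_convergence_implies_KV_conditions
    {H : Type*} [NormedAddCommGroup H] [InnerProductSpace ℂ H] [CompleteSpace H]
    (S A : H →L[ℂ] H)
    (hS : S.IsPositive) (hSinj : Function.Injective S)
    (hA : ContinuousLinearMap.adjoint A = -A)
    -- `S^{1/2}`: the (unique) positive square root of `S`
    (sqrtS : H →L[ℂ] H) (hsqrtS_pos : sqrtS.IsPositive) (hsqrtS_sq : sqrtS * sqrtS = S)
    -- `sq l = (l I + S)^{1/2}`: the positive square root of `l I + S`, invertible for `l > 0`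
    (sq : ℝ → H →L[ℂ] H)
    (hsq_pos : ∀ l : ℝ, 0 < l → (sq l).IsPositive)
    (hsq_sq : ∀ l : ℝ, 0 < l → sq l * sq l = (l : ℂ) • (1 : H →L[ℂ] H) + S)
    (hsq_unit : ∀ l : ℝ, 0 < l → IsUnit (sq l))
    -- the resolvent `(λ I - G)⁻¹` of `G = -S + A` exists for `λ > 0`
    (hres : ∀ l : ℝ, 0 < l → IsUnit ((l : ℂ) • (1 : H →L[ℂ] H) - (-S + A)))
    -- `K_λ → K` strongly as `λ → 0⁺`
    (K : H →L[ℂ] H)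
    (hK : ∀ x : H, Tendsto (fun l : ℝ =>
        (Ring.inverse (1 - Ring.inverse (sq l) * A * Ring.inverse (sq l))) x)
      (𝓝[>] (0:ℝ)) (𝓝 (K x))) :
    (∀ l : ℝ, 0 < l →
      IsUnit (1 - Ring.inverse (sq l) * A * Ring.inverse (sq l)) ∧
      ‖Ring.inverse (1 - Ring.inverse (sq l) * A * Ring.inverse (sq l))‖ ≤ 1) ∧
    ∀ g : H,
      Tendsto (fun l : ℝ => ((Real.sqrt l : ℂ)) •
          (Ring.inverse ((l : ℂ) • (1 : H →L[ℂ] H) - (-S + A))) (sqrtS g))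
        (𝓝[>] (0:ℝ)) (𝓝 (0:H)) ∧
      Tendsto (fun l : ℝ =>
          sqrtS ((Ring.inverse ((l : ℂ) • (1 : H →L[ℂ] H) - (-S + A))) (sqrtS g)))
        (𝓝[>] (0:ℝ)) (𝓝 (K g)) := by
  -- factorisation
  have hfac : ∀ l : ℝ, 0 < l →
      IsUnit (1 - Ring.inverse (sq l) * A * Ring.inverse (sq l)) ∧
      Ring.inverse ((l : ℂ) • (1 : H →L[ℂ] H) - (-S + A)) =
        Ring.inverse (sq l) * Ring.inverse (1 - Ring.inverse (sq l) * A * Ring.inverse (sq l))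
          * Ring.inverse (sq l) := by
    intro l hl
    have hu := hsq_unit l hl
    have h1 := Ring.mul_inverse_cancel _ hu
    have h2 := Ring.inverse_mul_cancel _ hu
    have hG : (l : ℂ) • (1 : H →L[ℂ] H) - (-S + A) = sq l * sq l - A := by
      rw [hsq_sq l hl]; abel
    have hr := hres l hl
    rw [hG] at hr ⊢
    generalize Ring.inverse (sq l) = R at *
    have hRu : IsUnit R := ⟨⟨R, sq l, h2, h1⟩, rfl⟩
    have hB : 1 - R * A * R = R * (sq l * sq l - A) * R := by
      rw [mul_sub, sub_mul, ← mul_assoc R, h2, one_mul, h1]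
    have hBu : IsUnit (1 - R * A * R) := by
      rw [hB]; exact (hRu.mul hr).mul hRu
    refine ⟨hBu, ?_⟩
    have hinvR : Ring.inverse R = sq l := by
      have h3 := Ring.inverse_mul_cancel _ hRu
      calc Ring.inverse R = Ring.inverse R * (R * sq l) := by rw [h2, mul_one]
        _ = sq l := by rw [← mul_assoc, h3, one_mul]
    rw [hB, Ring.inverse_mul (Or.inr hRu), Ring.inverse_mul (Or.inl hRu), hinvR]
    simp only [← mul_assoc]
    rw [h2, one_mul, mul_assoc, h1, mul_one]
  have hKle : ∀ l : ℝ, 0 < l → ∀ x,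
      ‖Ring.inverse (1 - Ring.inverse (sq l) * A * Ring.inverse (sq l)) x‖ ≤ ‖x‖ := by
    intro l hl x
    have h := kv_K A (sq l) _ hA (hsq_pos l hl) (Ring.mul_inverse_cancel _ (hsq_unit l hl))
      (Ring.inverse (1 - Ring.inverse (sq l) * A * Ring.inverse (sq l)) x)
    have e := congrArg (fun f : H →L[ℂ] H => f x) (Ring.mul_inverse_cancel _ (hfac l hl).1)
    exact h.trans (le_of_eq (congrArg norm e))
  have hcore := fun (l : ℝ) (hl : 0 < l) => kv_core S sqrtS (sq l) (Ring.inverse (sq l)) l hl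
    hsqrtS_pos hsqrtS_sq (hsq_pos l hl) (hsq_sq l hl)
    (Ring.mul_inverse_cancel _ (hsq_unit l hl)) (Ring.inverse_mul_cancel _ (hsq_unit l hl))
  refine ⟨fun l hl => ⟨(hfac l hl).1,
    ContinuousLinearMap.opNorm_le_bound _ zero_le_one (by simpa using hKle l hl)⟩, fun g => ?_⟩
  have hvle : ∀ l : ℝ, 0 < l → ∀ x, ‖Ring.inverse (sq l) (sqrtS x)‖ ≤ ‖x‖ := by
    intro l hl x
    have h := (hcore l hl).2.1 x
    have h2 : 0 ≤ l * ‖Ring.inverse (sq l) x‖ ^ 2 := by positivity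
    exact le_of_sq_le_sq (by linarith) (norm_nonneg _)
  have hwle : ∀ l : ℝ, 0 < l → ∀ x, ‖(Real.sqrt l : ℂ) • Ring.inverse (sq l) x‖ ≤ ‖x‖ := by
    intro l hl x
    have h := (hcore l hl).2.1 x
    apply le_of_sq_le_sq _ (norm_nonneg _)
    rw [norm_smul, mul_pow, Complex.norm_real, Real.norm_eq_abs, sq_abs, Real.sq_sqrt hl.le]
    nlinarith [sq_nonneg ‖Ring.inverse (sq l) (sqrtS x)‖]
  have hev : ∀ᶠ l : ℝ in 𝓝[>] (0:ℝ), 0 < l := eventually_mem_nhdsWithin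
  have hdense : DenseRange S := by
    have h1 : (LinearMap.range (S : H →ₗ[ℂ] H))ᗮ = ⊥ := by
      rw [Submodule.eq_bot_iff]
      intro x hx
      have h2 : S x = 0 := by
        have := hx (S (S x)) ⟨S x, rfl⟩
        rw [hS.inner_left_eq_inner_right] at this
        exact inner_self_eq_zero.1 this
      exact hSinj (by rw [h2, map_zero])
    have h3 := (Submodule.topologicalClosure_eq_top_iff).2 h1
    have h4 := Submodule.dense_iff_topologicalClosure_eq_top.2 h3
    exact h4
  have hV : ∀ x, Tendsto (fun l : ℝ => Ring.inverse (sq l) (sqrtS x)) (𝓝[>] (0:ℝ)) (𝓝 x) := by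
    intro x
    rw [Metric.tendsto_nhds]
    intro ε hε
    obtain ⟨h, hh⟩ := hdense.exists_dist_lt x (show 0 < ε / 3 by linarith)
    have hlim : Tendsto (fun l : ℝ => l * ‖h‖) (𝓝[>] (0:ℝ)) (𝓝 0) := by
      have : Tendsto (fun l : ℝ => l * ‖h‖) (𝓝 (0:ℝ)) (𝓝 (0 * ‖h‖)) :=
        tendsto_id.mul_const _
      rw [zero_mul] at this
      exact this.mono_left nhdsWithin_le_nhds
    filter_upwards [hev, hlim.eventually_lt_const (show 0 < ε / 3 by linarith)] with l hl hl2
    rw [dist_eq_norm] at hh ⊢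
    have e : Ring.inverse (sq l) (sqrtS x) - x = Ring.inverse (sq l) (sqrtS (x - S h))
        + (Ring.inverse (sq l) (sqrtS (S h)) - S h) - (x - S h) := by
      rw [map_sub, map_sub]; abel
    rw [e]
    have a1 := hvle l hl (x - S h)
    have a2 := (hcore l hl).2.2 h
    have a3 := norm_sub_le (Ring.inverse (sq l) (sqrtS (x - S h))
        + (Ring.inverse (sq l) (sqrtS (S h)) - S h)) (x - S h)
    have a4 := norm_add_le (Ring.inverse (sq l) (sqrtS (x - S h)))
        (Ring.inverse (sq l) (sqrtS (S h)) - S h)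
    linarith
  have hW : ∀ x, Tendsto (fun l : ℝ => (Real.sqrt l : ℂ) • Ring.inverse (sq l) x)
      (𝓝[>] (0:ℝ)) (𝓝 0) := by
    intro x
    rw [tendsto_zero_iff_norm_tendsto_zero]
    have h1 : Tendsto (fun l : ℝ => Real.sqrt (‖x‖ ^ 2 - ‖Ring.inverse (sq l) (sqrtS x)‖ ^ 2))
        (𝓝[>] (0:ℝ)) (𝓝 0) := by
      have := (((hV x).norm.pow 2).const_sub (‖x‖ ^ 2)).sqrt
      simpa using this
    refine h1.congr' ?_
    filter_upwards [hev] with l hl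
    rw [← (hcore l hl).2.1 x, add_sub_cancel_right, Real.sqrt_mul hl.le,
      Real.sqrt_sq (norm_nonneg _), norm_smul, Complex.norm_real, Real.norm_eq_abs,
      abs_of_nonneg (Real.sqrt_nonneg _)]
  -- general principle: contractions applied to a convergent family
  have gen : ∀ (P : ℝ → H →L[ℂ] H) (v : ℝ → H) (a b : H),
      (∀ l : ℝ, 0 < l → ∀ x, ‖P l x‖ ≤ ‖x‖) →
      Tendsto v (𝓝[>] (0:ℝ)) (𝓝 a) → Tendsto (fun l => P l a) (𝓝[>] (0:ℝ)) (𝓝 b) →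
      Tendsto (fun l => P l (v l)) (𝓝[>] (0:ℝ)) (𝓝 b) := by
    intro P v a b hP hv hPa
    have h1 : Tendsto (fun l => P l (v l - a)) (𝓝[>] (0:ℝ)) (𝓝 0) := by
      have h2 : Tendsto (fun l => ‖v l - a‖) (𝓝[>] (0:ℝ)) (𝓝 0) :=
        tendsto_iff_norm_sub_tendsto_zero.1 hv
      refine squeeze_zero_norm' ?_ h2
      filter_upwards [hev] with l hl using hP l hl _
    have h3 := h1.add hPa
    rw [zero_add] at h3
    refine h3.congr fun l => ?_
    rw [map_sub, sub_add_cancel]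
  have hKV := gen _ _ _ _ hKle (hV g) (hK g)
  constructor
  · have h := gen (fun l => (Real.sqrt l : ℂ) • Ring.inverse (sq l)) _ _ _ hwle hKV (hW _)
    refine h.congr' ?_
    filter_upwards [hev] with l hl
    rw [(hfac l hl).2]
    rfl
  · have h := gen (fun l => Ring.inverse (sq l) * sqrtS) _ _ _ hvle hKV (hV _)
    refine h.congr' ?_
    filter_upwards [hev] with l hl
    rw [(hfac l hl).2]
    exact ((hcore l hl).1 _).symm
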